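/- Let M be a matroid on a finite ground set E, let e be a coloop of M, and let C be a circuit of M (necessarily e ∉ C). Let C' = C be the corresponding circuit of the contraction M/{e}. Then the winning probability of C in the matroid bingo game on M equals the winning probability of C' in the matroid bingo game on M/{e}: β_C = β_{C'}. -/

import Mathlib

open Finset

/-- A matroid presented by its collection of circuits (the valid sets of bingo
cards): nonempty ground set axioms (C1)-(C3) of the paper. -/
structure BingoMatroid (α : Type*) [DecidableEq α] where
  /-- the ground set -/
  E : Finset α
  /-- the circuits (bingo cards) -/
  circuits : Finset (Finset α)
  subset_ground : ∀ C ∈ circuits, C ⊆ E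
  empty_not_mem : ∅ ∉ circuits
  antichain : ∀ C₁ ∈ circuits, ∀ C₂ ∈ circuits, C₁ ⊆ C₂ → C₁ = C₂
  elimination : ∀ C₁ ∈ circuits, ∀ C₂ ∈ circuits, C₁ ≠ C₂ →
    ∀ e ∈ C₁ ∩ C₂, ∃ C₃ ∈ circuits, C₃ ⊆ (C₁ ∪ C₂) \ {e}

/-- The completion time `t_C(σ)`: the least `t` such that every element of `C`
has been called out among the first `t` values of `σ`. -/
noncomputable def hitTime {α : Type*} {n : ℕ} (σ : Fin n → α) (C : Finset α) : ℕ :=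
  sInf {t : ℕ | ∀ x ∈ C, ∃ i : Fin n, (i : ℕ) < t ∧ σ i = x}

namespace BingoMatroid

variable {α : Type*} [DecidableEq α]

/-- `C` wins the bingo game under calling order `σ`: it is completed strictly
before every other circuit. -/
def Wins (M : BingoMatroid α) (σ : Fin M.E.card ≃ {x // x ∈ M.E}) (C : Finset α) : Prop :=
  ∀ C' ∈ M.circuits, C' ≠ C →
    hitTime (fun i => (σ i : α)) C < hitTime (fun i => (σ i : α)) C'

/-- The winning probability `β_C`: the number of calling orders under which `C`
wins, divided by `n!`. -/
noncomputable def beta (M : BingoMatroid α) (C : Finset α) : ℚ :=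
  (Nat.card {σ : Fin M.E.card ≃ {x // x ∈ M.E} // M.Wins σ C} : ℚ) /
    (Nat.factorial M.E.card : ℚ)

/-- The timed winning probability `β_C(t)`: the probability that `C` wins and is
completed exactly in round `t`. -/
noncomputable def betaT (M : BingoMatroid α) (C : Finset α) (t : ℕ) : ℚ :=
  (Nat.card {σ : Fin M.E.card ≃ {x // x ∈ M.E} //
      M.Wins σ C ∧ hitTime (fun i => (σ i : α)) C = t} : ℚ) /
    (Nat.factorial M.E.card : ℚ)

/-- A set is independent if it is contained in the ground set and contains no circuit. -/
def Indep (M : BingoMatroid α) (I : Finset α) : Prop :=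
  I ⊆ M.E ∧ ∀ C ∈ M.circuits, ¬ C ⊆ I

/-- The rank of the matroid: the maximum size of an independent set. -/
noncomputable def rank (M : BingoMatroid α) : ℕ :=
  sSup {k : ℕ | ∃ I : Finset α, M.Indep I ∧ I.card = k}

/-- A basis is a maximal independent set. -/
def IsBase (M : BingoMatroid α) (B : Finset α) : Prop :=
  M.Indep B ∧ ∀ J : Finset α, M.Indep J → B ⊆ J → B = J

/-- A coloop is an element of the ground set contained in no circuit. -/
def IsColoop (M : BingoMatroid α) (e : α) : Prop :=
  e ∈ M.E ∧ ∀ C ∈ M.circuits, e ∉ C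

/-- `D` is a circuit of the contraction `M/T`: a nonempty inclusion-minimal
member of `{C \ T : C a circuit of M}`. -/
def IsContractCircuit (M : BingoMatroid α) (T D : Finset α) : Prop :=
  D.Nonempty ∧ (∃ C ∈ M.circuits, D = C \ T) ∧
    ∀ C' ∈ M.circuits, (C' \ T).Nonempty → ¬ (C' \ T) ⊂ D

end BingoMatroid

theorem hitTime_le_iff {α : Type*} {n : ℕ} {σ : Fin n → α} {C : Finset α}
    (hC : ∀ x ∈ C, ∃ i, σ i = x) (t : ℕ) :
    hitTime σ C ≤ t ↔ ∀ x ∈ C, ∃ i : Fin n, (i : ℕ) < t ∧ σ i = x := by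
  refine ⟨fun h x hx => ?_, fun h => Nat.sInf_le h⟩
  have hne : {t : ℕ | ∀ x ∈ C, ∃ i : Fin n, (i : ℕ) < t ∧ σ i = x}.Nonempty :=
    ⟨n, fun x hx => (hC x hx).imp fun i hi => ⟨i.isLt, hi⟩⟩
  obtain ⟨i, hi, hix⟩ := Nat.sInf_mem hne x hx
  exact ⟨i, hi.trans_le h, hix⟩

theorem hitTime_lt_hitTime_iff {α : Type*} {n : ℕ} {σ : Fin n → α} {C D : Finset α}
    (hC : ∀ x ∈ C, ∃ i, σ i = x) (hD : ∀ x ∈ D, ∃ i, σ i = x) :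
    hitTime σ C < hitTime σ D ↔
      ∃ x ∈ D, ∀ i, σ i = x → ∀ y ∈ C, ∃ j, j < i ∧ σ j = y := by
  rw [← not_le, hitTime_le_iff hD]
  push Not
  refine exists_congr fun x => and_congr_right fun _ => forall_congr' fun i => ?_
  rw [ne_eq, imp_not_comm, not_lt, hitTime_le_iff hC]
  simp only [Fin.lt_def]

/-- Removing from a calling order an element outside `C` and `D` does not affect which of the two
is completed first. -/
theorem hitTime_lt_hitTime_succAbove_iff {α : Type*} {m : ℕ} {σ : Fin (m + 1) → α}
    {C D : Finset α} (hC : ∀ x ∈ C, ∃ i, σ i = x) (hD : ∀ x ∈ D, ∃ i, σ i = x)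
    (p : Fin (m + 1)) (hpC : σ p ∉ C) (hpD : σ p ∉ D) :
    hitTime (fun i => σ (p.succAbove i)) C < hitTime (fun i => σ (p.succAbove i)) D ↔
      hitTime σ C < hitTime σ D := by
  have restrict {S : Finset α} (hS : ∀ x ∈ S, ∃ i, σ i = x) (hp : σ p ∉ S) :
      ∀ x ∈ S, ∃ i, σ (p.succAbove i) = x := fun x hx => by
    rcases (Fin.exists_iff_succAbove p).1 (hS x hx) with h | h
    · exact absurd (h ▸ hx) hp
    · exact h
  rw [hitTime_lt_hitTime_iff hC hD,
    hitTime_lt_hitTime_iff (restrict hC hpC) (restrict hD hpD)]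
  refine exists_congr fun x => and_congr_right fun hx => ?_
  have hpx : σ p ≠ x := fun h => hpD (h ▸ hx)
  rw [Fin.forall_iff_succAbove p]
  simp only [hpx, false_imp_iff, true_and]
  refine forall_congr' fun i => imp_congr_right fun _ => forall₂_congr fun y hy => ?_
  have hpy : σ p ≠ y := fun h => hpC (h ▸ hy)
  rw [Fin.exists_iff_succAbove p]
  simp [hpy]

/-- Insert `e` at position `p` into an enumeration of `E \ {e}`. -/
def insertCall {α : Type*} [DecidableEq α] {E E' : Finset α} {e : α} (he : e ∈ E)
    (hE : E' = E \ {e}) {m : ℕ} (p : Fin (m + 1)) (τ : Fin m ≃ {x // x ∈ E'}) :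
    Fin (m + 1) ≃ {x // x ∈ E} :=
  (finSuccEquiv' p).trans <| (Equiv.optionCongr τ).trans
    { toFun := fun o => o.elim ⟨e, he⟩ fun x => ⟨x, by have := x.2; grind⟩
      invFun := fun x => if h : (x : α) = e then none else some ⟨x, by have := x.2; grind⟩
      left_inv := by rintro (_ | ⟨x, hx⟩) <;> simp; grind
      right_inv := by rintro ⟨x, hx⟩; by_cases h : x = e <;> simp [h] }

theorem insertCall_self {α : Type*} [DecidableEq α] {E E' : Finset α} {e : α} (he : e ∈ E)
    (hE : E' = E \ {e}) {m : ℕ} (p : Fin (m + 1)) (τ : Fin m ≃ {x // x ∈ E'}) :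
    (insertCall he hE p τ p : α) = e := by
  simp [insertCall]

theorem insertCall_succAbove {α : Type*} [DecidableEq α] {E E' : Finset α} {e : α} (he : e ∈ E)
    (hE : E' = E \ {e}) {m : ℕ} (p : Fin (m + 1)) (τ : Fin m ≃ {x // x ∈ E'}) (i : Fin m) :
    (insertCall he hE p τ (p.succAbove i) : α) = τ i := by
  simp [insertCall]

theorem insertCall_bijective {α : Type*} [DecidableEq α] {E E' : Finset α} {e : α} (he : e ∈ E)
    (hE : E' = E \ {e}) {m : ℕ} (hm : E'.card = m) :
    Function.Bijective fun q : Fin (m + 1) × (Fin m ≃ {x // x ∈ E'}) =>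
      insertCall he hE q.1 q.2 := by
  classical
  have hcard : E.card = m + 1 := by
    rw [← hm, hE, ← Finset.erase_eq, Finset.card_erase_add_one he]
  rw [Fintype.bijective_iff_injective_and_card]
  constructor
  · rintro ⟨p, τ⟩ ⟨q, υ⟩ h
    dsimp only at h
    obtain rfl : p = q := (insertCall he hE p τ).injective <| Subtype.ext <| by
      rw [insertCall_self, h, insertCall_self]
    congr 1
    ext i
    rw [← insertCall_succAbove he hE, h, insertCall_succAbove]
  · rw [Fintype.card_prod,
      Fintype.card_equiv ((Fintype.equivFinOfCardEq (by simpa using hm)).symm :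
        Fin m ≃ {x // x ∈ E'}),
      Fintype.card_equiv ((Fintype.equivFinOfCardEq (by simpa using hcard)).symm :
        Fin (m + 1) ≃ {x // x ∈ E})]
    simp [Nat.factorial_succ]

theorem card_winning_orders {α : Type*} [DecidableEq α] {E E' : Finset α} {e : α} (he : e ∈ E)
    (hE : E' = E \ {e}) {m : ℕ}
    (hm : E'.card = m) {n : ℕ} (hn : n = m + 1) {C : Finset α}
    {𝒞 : Finset (Finset α)} (hC : C ⊆ E) (heC : e ∉ C) (h𝒞 : ∀ D ∈ 𝒞, D ⊆ E ∧ e ∉ D) :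
    Nat.card {σ : Fin n ≃ {x // x ∈ E} // ∀ D ∈ 𝒞, D ≠ C →
        hitTime (fun i => (σ i : α)) C < hitTime (fun i => (σ i : α)) D} =
      n * Nat.card {τ : Fin m ≃ {x // x ∈ E'} // ∀ D ∈ 𝒞, D ≠ C →
        hitTime (fun i => (τ i : α)) C < hitTime (fun i => (τ i : α)) D} := by
  subst hn
  have hsurj (σ : Fin (m + 1) ≃ {x // x ∈ E}) {S : Finset α} (hS : S ⊆ E) :
      ∀ x ∈ S, ∃ i, (σ i : α) = x := fun x hx =>
    ⟨σ.symm ⟨x, hS hx⟩, by simp⟩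
  rw [← Nat.card_congr (Equiv.subtypeEquiv (Equiv.ofBijective _ (insertCall_bijective he hE hm))
    (p := fun q => q.1 ∈ Set.univ ∧ ∀ D ∈ 𝒞, D ≠ C →
      hitTime (fun i => (q.2 i : α)) C < hitTime (fun i => (q.2 i : α)) D) ?_)]
  · rw [Nat.card_congr (Equiv.subtypeProdEquivProd (p := fun p => p ∈ Set.univ)
      (q := fun τ : Fin m ≃ {x // x ∈ E'} => ∀ D ∈ 𝒞, D ≠ C →
        hitTime (fun i => (τ i : α)) C < hitTime (fun i => (τ i : α)) D)), Nat.card_prod]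
    simp
  · rintro ⟨p, τ⟩
    simp only [Set.mem_univ, true_and, Equiv.ofBijective_apply]
    refine forall₃_congr fun D hD _ => ?_
    rw [← hitTime_lt_hitTime_succAbove_iff (hsurj _ hC) (hsurj _ (h𝒞 D hD).1) p
      (by rwa [insertCall_self]) (by rw [insertCall_self]; exact (h𝒞 D hD).2)]
    simp only [insertCall_succAbove]

/-- contracting a coloop does not change winning probabilities:
if `M'` is the contraction `M/{e}` of `M` by a coloop `e` (same circuits,
ground set `E \ {e}`), then `β_C` is the same in both games. -/
theorem stmt18 {α : Type*} [DecidableEq α] (M M' : BingoMatroid α) (hE : M.E.Nonempty)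
    (e : α) (he : M.IsColoop e) (C : Finset α) (hC : C ∈ M.circuits)
    (hE' : M'.E = M.E \ {e}) (hcirc : M'.circuits = M.circuits) :
    M.beta C = M'.beta C := by
  have hcard : M.E.card = M'.E.card + 1 := by
    rw [hE', ← Finset.erase_eq, Finset.card_erase_add_one he.1]
  unfold BingoMatroid.beta BingoMatroid.Wins
  rw [hcirc, card_winning_orders he.1 hE' rfl hcard (M.subset_ground C hC) (he.2 C hC)
    fun D hD => ⟨M.subset_ground D hD, he.2 D hD⟩, hcard, Nat.factorial_succ]
  push_cast
  exact mul_div_mul_left _ _ (by positivity)
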